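/- Fix integers T, d, ℓ ≥ 1 and ε > 0, write m = Tℓ, and let μ be a 2^{−m}-measure on [0,1)^d. Then there exists a family of pairwise disjoint 2^{−m}-sets X₁,…,X_N, each contained in the dyadic support supp_d(μ), such that: (i) μ(X₁ ∪ … ∪ X_N) ≥ 1 − 2^{−εm}, and consequently for every Borel set A with μ(A) > 2^{−εm} there exists i with μ_{X_i}(A) ≥ μ(A) − 2^{−εm}; (ii) μ(X_i) ≥ 2^{−(ε + (1/T)·log₂(2dT+2))·m} for every i; (iii) each μ_{X_i} is σ(i)-regular for some sequence σ(i) ∈ [−1, d−1]^ℓ. -/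

import Mathlib

open MeasureTheory
open scoped ENNReal NNReal

/-- The half-open dyadic cube of side length `2⁻ⁿ` in `ℝ^d` indexed by `k ∈ ℤ^d`. -/
def dyadicCube (d n : ℕ) (k : Fin d → ℤ) : Set (EuclideanSpace ℝ (Fin d)) :=
  {x | ∀ i, (k i : ℝ) / 2 ^ n ≤ x i ∧ x i < ((k i : ℝ) + 1) / 2 ^ n}

/-- A `2⁻ᵐ`-measure: a Borel probability measure on `[0,1)^d` whose restriction to each
dyadic cube of side length `2⁻ᵐ` is a multiple of Lebesgue measure. -/
def IsDyadicMeasure (d m : ℕ) (μ : Measure (EuclideanSpace ℝ (Fin d))) : Prop :=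
  IsProbabilityMeasure μ ∧
  μ {x : EuclideanSpace ℝ (Fin d) | ∀ i, 0 ≤ x i ∧ x i < 1}ᶜ = 0 ∧
  ∀ k : Fin d → ℤ, ∃ c : ℝ≥0∞,
    μ.restrict (dyadicCube d m k) = c • volume.restrict (dyadicCube d m k)

/-- A `σ`-regular measure (for `σ = (σ_1, …, σ_ℓ)`): a `2^{-Tℓ}`-measure such that for every
dyadic cube `Q` of side `2^{-jT}` (`1 ≤ j ≤ ℓ`) of positive measure,
`ν(Q) ≤ 2^{-T(σ_j+1)} ν(Q̂) ≤ 2 ν(Q)`, where `Q̂` is the parent cube of side `2^{-(j-1)T}`. -/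
def IsRegularMeasure (d T ℓ : ℕ) (σ : ℕ → ℝ) (ν : Measure (EuclideanSpace ℝ (Fin d))) : Prop :=
  IsDyadicMeasure d (T * ℓ) ν ∧
  ∀ j, 1 ≤ j → j ≤ ℓ → ∀ k : Fin d → ℤ,
    0 < ν (dyadicCube d (T * j) k) →
      ν (dyadicCube d (T * j) k) ≤
        ENNReal.ofReal ((2 : ℝ) ^ (-(T : ℝ) * (σ j + 1))) *
          ν (dyadicCube d (T * (j - 1)) fun i => (k i).fdiv (2 ^ T)) ∧
      ENNReal.ofReal ((2 : ℝ) ^ (-(T : ℝ) * (σ j + 1))) *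
          ν (dyadicCube d (T * (j - 1)) fun i => (k i).fdiv (2 ^ T)) ≤
        2 * ν (dyadicCube d (T * j) k)

/-- The dyadic support of `μ`: the points all of whose dyadic cubes (of sides `2^{-jT}`,
`j ∈ ℕ`) have positive measure. -/
def dyadicSupport (d T : ℕ) (μ : Measure (EuclideanSpace ℝ (Fin d))) :
    Set (EuclideanSpace ℝ (Fin d)) :=
  {x | ∀ j : ℕ, 0 < μ (dyadicCube d (T * j) fun i => ⌊x i * 2 ^ (T * j)⌋)}

/-- The branching number prescribed for a window containing `n` comparable weights. -/
noncomputable def branchLabel (n : ℕ) : ℝ :=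
  if n ≤ 3 then (2 + 3 * n) / 5 else if n = 4 then 11 / 5 else 3 * n / 5

/-- The mass, in units of the largest weight, that can be retained from a window of `n` weights. -/
noncomputable def retainedMass (n : ℕ) : ℝ := if n = 4 then 9 / 5 else 3 * n / 5

/-- The weight given to `branchLabel n` in the pigeonhole argument. -/
noncomputable def labelWeight (n : ℕ) : ℝ := 3 / 2 / retainedMass n

/-- `S` has branching number `a`: every weight is `a⁻¹` times the total, up to a factor `2`. -/
def IsBalanced {α : Type*} (p : α → ℝ) (a : ℝ) (S : Finset α) : Prop :=
  ∀ c ∈ S, a * p c ≤ ∑ i ∈ S, p i ∧ ∑ i ∈ S, p i ≤ 2 * a * p c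

lemma retainedMass_pos {n : ℕ} (hn : 1 ≤ n) : 0 < retainedMass n := by
  have : (1 : ℝ) ≤ n := by exact_mod_cast hn
  unfold retainedMass
  split_ifs <;> linarith

lemma labelWeight_pos {n : ℕ} (hn : 1 ≤ n) : 0 < labelWeight n :=
  div_pos (by norm_num) (retainedMass_pos hn)

lemma one_le_branchLabel {n : ℕ} (hn : 1 ≤ n) : 1 ≤ branchLabel n := by
  have : (1 : ℝ) ≤ n := by exact_mod_cast hn
  unfold branchLabel
  split_ifs with h h'
  · linarith
  · norm_num
  · have : (5 : ℝ) ≤ n := by exact_mod_cast (by omega : 5 ≤ n)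
    linarith

lemma branchLabel_le {n : ℕ} (hn : 1 ≤ n) : branchLabel n ≤ n := by
  have : (1 : ℝ) ≤ n := by exact_mod_cast hn
  unfold branchLabel
  split_ifs with h h'
  · linarith
  · subst h'; norm_num
  · linarith

lemma sum_labelWeight_le {D : ℕ} (hD : 1 ≤ D) :
    ∑ n ∈ Finset.Icc 1 (2 ^ D), labelWeight n ≤ 2 * D + 2 := by
  rcases lt_or_ge D 3 with h | h
  · interval_cases D
    · norm_num [Finset.sum_Icc_succ_top, labelWeight, retainedMass]
    · norm_num [Finset.sum_Icc_succ_top, labelWeight, retainedMass]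
  · have h1 : ∀ n ∈ Finset.Icc 1 (2 ^ D), labelWeight n ≤
        5 / 2 * (n : ℝ)⁻¹ + if n = 4 then 5 / 24 else 0 := by
      intro n hn
      have hn1 : 1 ≤ n := (Finset.mem_Icc.1 hn).1
      have : (n : ℝ) ≠ 0 := by positivity
      unfold labelWeight retainedMass
      split_ifs with h4
      · subst h4; norm_num
      · apply le_of_eq; field_simp; norm_num
    have h2 := harmonic_le_one_add_log (2 ^ D)
    rw [harmonic_eq_sum_Icc] at h2
    push_cast at h2
    rw [Real.log_pow] at h2
    have h3 := Real.log_two_lt_d9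
    have h4 : (3 : ℝ) ≤ D := by exact_mod_cast h
    have h5 : (D : ℝ) * Real.log 2 ≤ D * 0.6931471808 :=
      mul_le_mul_of_nonneg_left h3.le (by positivity)
    refine (Finset.sum_le_sum h1).trans ?_
    rw [Finset.sum_add_distrib, ← Finset.mul_sum]
    have h6 : (∑ n ∈ Finset.Icc 1 (2 ^ D), if n = 4 then (5 / 24 : ℝ) else 0) ≤ 5 / 24 := by
      rw [Finset.sum_ite_eq']
      split_ifs <;> norm_num
    linarith

lemma isBalanced_of_card_le_three {α : Type*} {p : α → ℝ} {s : Finset α} {u : ℝ}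
    (hu : 0 ≤ u) (hp : ∀ i ∈ s, 3 / 5 * u ≤ p i ∧ p i ≤ u) (hs : s.card ≤ 3) :
    IsBalanced p ((2 + 3 * s.card) / 5) s := by
  classical
  intro c hc
  have hlo := Finset.card_nsmul_le_sum (s.erase c) p (3 / 5 * u)
    fun i hi => (hp i (Finset.mem_of_mem_erase hi)).1
  have hhi := Finset.sum_le_card_nsmul (s.erase c) p u
    fun i hi => (hp i (Finset.mem_of_mem_erase hi)).2
  have hcard := Finset.card_erase_add_one hc
  have hsum := Finset.add_sum_erase s p hc
  obtain ⟨hc1, hc2⟩ := hp c hc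
  rw [nsmul_eq_mul] at hlo hhi
  rw [← hsum, ← hcard]
  set m := (s.erase c).card
  have hm : m ≤ 2 := by omega
  interval_cases m <;> constructor <;> push_cast at * <;> linarith

lemma exists_isBalanced_of_sum_ge {α : Type*} {p : α → ℝ} {s : Finset α} {u a : ℝ}
    (hu : 0 ≤ u) (ha : 3 ≤ a) (hp : ∀ i ∈ s, 3 / 5 * u ≤ p i ∧ p i ≤ u)
    (hs : a * u ≤ ∑ i ∈ s, p i) :
    ∃ S ⊆ s, IsBalanced p a S ∧ a * u ≤ ∑ i ∈ S, p i := by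
  classical
  obtain ⟨S, hS, hmin⟩ := Finset.exists_min_image
    (s.powerset.filter fun S => a * u ≤ ∑ i ∈ S, p i) Finset.card ⟨s, by simpa using hs⟩
  simp only [Finset.mem_filter, Finset.mem_powerset] at hS hmin
  refine ⟨S, hS.1, fun c hc => ⟨?_, ?_⟩, hS.2⟩
  · exact (mul_le_mul_of_nonneg_left (hp c (hS.1 hc)).2 (by linarith)).trans hS.2
  · have hlt : ∑ i ∈ S.erase c, p i < a * u := by
      by_contra! h
      have := hmin (S.erase c) ⟨(Finset.erase_subset _ _).trans hS.1, h⟩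
      have := Finset.card_erase_lt_of_mem hc
      omega
    have := Finset.add_sum_erase S p hc
    have hc1 := (hp c (hS.1 hc)).1
    nlinarith [mul_nonneg (sub_nonneg.2 ha) hu,
      mul_nonneg (by linarith : 0 ≤ 2 * a - 1) (sub_nonneg.2 hc1)]

lemma exists_isBalanced_branchLabel {α : Type*} {p : α → ℝ} {s : Finset α} {u : ℝ} {n : ℕ}
    (hu : 0 ≤ u) (hp : ∀ i ∈ s, 3 / 5 * u ≤ p i ∧ p i ≤ u) (hn : n ≤ s.card) :
    ∃ S ⊆ s, IsBalanced p (branchLabel n) S ∧ retainedMass n * u ≤ ∑ i ∈ S, p i := by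
  have small : ∀ k ≤ 3, k ≤ s.card → ∃ S ⊆ s, IsBalanced p ((2 + 3 * k) / 5) S ∧
      3 * k / 5 * u ≤ ∑ i ∈ S, p i := by
    intro k hk hks
    obtain ⟨S, hS, rfl⟩ := Finset.exists_subset_card_eq hks
    refine ⟨S, hS, isBalanced_of_card_le_three hu (fun i hi => hp i (hS hi)) hk, ?_⟩
    have := Finset.card_nsmul_le_sum S p (3 / 5 * u) fun i hi => (hp i (hS hi)).1
    rw [nsmul_eq_mul] at this
    linarith
  unfold branchLabel retainedMass
  by_cases h3 : n ≤ 3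
  · rw [if_pos h3, if_neg (by omega)]
    exact small n h3 hn
  by_cases h4 : n = 4
  · rw [if_neg h3, if_pos h4, if_pos h4]
    convert small 3 le_rfl (by omega) using 5 <;> norm_num
  · rw [if_neg h3, if_neg h4, if_neg h4]
    have h5 : (5 : ℝ) ≤ n := by exact_mod_cast (by omega : 5 ≤ n)
    refine exists_isBalanced_of_sum_ge hu (by linarith) hp ?_
    have := Finset.card_nsmul_le_sum s p (3 / 5 * u) fun i hi => (hp i hi).1
    rw [nsmul_eq_mul] at this
    have hn' : (n : ℝ) ≤ s.card := by exact_mod_cast hn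
    nlinarith [mul_le_mul_of_nonneg_right hn' hu]

/-- If every real `u` lies in at most as many of the intervals `[p i, 5 p i / 3]` as of the
intervals `[0, c n]`, then the total lengths compare. -/
lemma sum_le_of_card_window_le {α : Type*} {p : α → ℝ} {s : Finset α} {c : ℕ → ℝ} {N : ℕ}
    (hp : ∀ i ∈ s, 0 ≤ p i) (hN : s.card ≤ N) (hc : ∀ n ∈ Finset.Icc 1 N, 0 ≤ c n)
    (h : ∀ u, 0 ≤ u → ∀ n, 1 ≤ n →
      n ≤ (s.filter fun i => 3 / 5 * u ≤ p i ∧ p i ≤ u).card → u ≤ c n) :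
    ∑ i ∈ s, 2 / 3 * p i ≤ ∑ n ∈ Finset.Icc 1 N, c n := by
  have key : ∀ u : ℝ, ∑ i ∈ s, (Set.Icc (p i) (5 / 3 * p i)).indicator (1 : ℝ → ℝ≥0∞) u ≤
      ∑ n ∈ Finset.Icc 1 N, (Set.Icc 0 (c n)).indicator (1 : ℝ → ℝ≥0∞) u := by
    intro u
    set F := s.filter fun i => 3 / 5 * u ≤ p i ∧ p i ≤ u with hF
    have h1 : ∑ i ∈ s, (Set.Icc (p i) (5 / 3 * p i)).indicator (1 : ℝ → ℝ≥0∞) u = F.card := by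
      rw [hF, Finset.card_filter, Nat.cast_sum]
      refine Finset.sum_congr rfl fun i _ => ?_
      rw [Set.indicator_apply]
      have : u ∈ Set.Icc (p i) (5 / 3 * p i) ↔ 3 / 5 * u ≤ p i ∧ p i ≤ u := by
        rw [Set.mem_Icc]
        constructor <;> rintro ⟨h1, h2⟩ <;> constructor <;> linarith
      simp only [this]
      split_ifs <;> simp
    rw [h1]
    rcases Finset.eq_empty_or_nonempty F with h0 | ⟨i, hi⟩
    · simp [h0]
    have hu : 0 ≤ u := by
      rw [hF, Finset.mem_filter] at hi
      exact (hp i hi.1).trans hi.2.2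
    have hsub : Finset.Icc 1 F.card ⊆ Finset.Icc 1 N :=
      Finset.Icc_subset_Icc_right ((Finset.card_filter_le _ _).trans hN)
    refine le_trans ?_ (Finset.sum_le_sum_of_subset hsub)
    have : ∀ n ∈ Finset.Icc 1 F.card, (Set.Icc 0 (c n)).indicator (1 : ℝ → ℝ≥0∞) u = 1 := by
      intro n hn
      rw [Finset.mem_Icc] at hn
      rw [Set.indicator_of_mem (show u ∈ Set.Icc 0 (c n) from ⟨hu, h u hu n hn.1 hn.2⟩)]
      rfl
    rw [Finset.sum_congr rfl this]
    simp
  have hlen := lintegral_mono (μ := volume) key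
  rw [lintegral_finsetSum _ fun i _ => measurable_one.indicator measurableSet_Icc,
    lintegral_finsetSum _ fun i _ => measurable_one.indicator measurableSet_Icc] at hlen
  simp only [lintegral_indicator_one measurableSet_Icc, Real.volume_Icc, sub_zero] at hlen
  rw [← ENNReal.ofReal_sum_of_nonneg fun i hi => by have := hp i hi; linarith,
    ← ENNReal.ofReal_sum_of_nonneg hc,
    ENNReal.ofReal_le_ofReal_iff (Finset.sum_nonneg hc)] at hlen
  refine le_trans (le_of_eq (Finset.sum_congr rfl fun i _ => ?_)) hlen
  ring

lemma exists_isBalanced_family {α : Type*} {p : α → ℝ} {s : Finset α} {N : ℕ}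
    (hp : ∀ i ∈ s, 0 ≤ p i) (hN : s.card ≤ N) :
    ∃ S : ℕ → Finset α, (∀ n, S n ⊆ s ∧ IsBalanced p (branchLabel n) (S n)) ∧
      ∑ i ∈ s, p i ≤ ∑ n ∈ Finset.Icc 1 N, labelWeight n * ∑ i ∈ S n, p i := by
  classical
  have hmax : ∀ n, ∃ S ⊆ s, IsBalanced p (branchLabel n) S ∧
      ∀ S' ⊆ s, IsBalanced p (branchLabel n) S' → ∑ i ∈ S', p i ≤ ∑ i ∈ S, p i := by
    intro n
    obtain ⟨S, hS, h⟩ := Finset.exists_max_image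
      (s.powerset.filter fun S => IsBalanced p (branchLabel n) S) (fun S => ∑ i ∈ S, p i)
      ⟨∅, Finset.mem_filter.2 ⟨Finset.empty_mem_powerset s, fun c hc => by simp at hc⟩⟩
    simp only [Finset.mem_filter, Finset.mem_powerset] at hS h
    exact ⟨S, hS.1, hS.2, fun S' h1 h2 => h S' ⟨h1, h2⟩⟩
  choose S hSs hS hSmax using hmax
  refine ⟨S, fun n => ⟨hSs n, hS n⟩, ?_⟩
  have := sum_le_of_card_window_le (c := fun n => (∑ i ∈ S n, p i) / retainedMass n) hp hN
    (fun n hn => div_nonneg (Finset.sum_nonneg fun i hi => hp i (hSs n hi))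
      (retainedMass_pos (Finset.mem_Icc.1 hn).1).le) ?_
  · rw [← Finset.mul_sum] at this
    calc ∑ i ∈ s, p i = 3 / 2 * (2 / 3 * ∑ i ∈ s, p i) := by ring
      _ ≤ 3 / 2 * ∑ n ∈ Finset.Icc 1 N, (∑ i ∈ S n, p i) / retainedMass n := by gcongr
      _ = _ := by
        rw [Finset.mul_sum]
        refine Finset.sum_congr rfl fun n _ => ?_
        unfold labelWeight
        ring
  · intro u hu n hn hcard
    rw [le_div_iff₀ (retainedMass_pos hn), mul_comm]
    obtain ⟨S', hS', hb, hm⟩ := exists_isBalanced_branchLabel hu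
      (fun i hi => (Finset.mem_filter.1 hi).2) hcard
    exact hm.trans (hSmax n S' (hS'.trans (Finset.filter_subset _ _)) hb)

/-- One step of regularization: a family of weights grouped into fibres of size at most `2 ^ D`
has a subfamily, carrying a proportion at least `1 / (2 D + 2)` of the mass, whose nonempty
fibres are all balanced with a common branching number. -/
lemma exists_balanced_fibres {α β : Type*} [DecidableEq β] {D : ℕ} (hD : 1 ≤ D)
    (C : Finset α) (g : α → β) (p : α → ℝ) (hp : ∀ i ∈ C, 0 ≤ p i)
    (hcard : ∀ b, (C.filter fun c => g c = b).card ≤ 2 ^ D) :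
    ∃ a ∈ Set.Icc (1 : ℝ) (2 ^ D), ∃ S ⊆ C,
      (∀ b, IsBalanced p a (S.filter fun c => g c = b)) ∧
      ∑ i ∈ C, p i ≤ (2 * D + 2) * ∑ i ∈ S, p i := by
  classical
  choose S hS hsum using fun b => exists_isBalanced_family (p := p)
    (s := C.filter fun c => g c = b) (fun i hi => hp i (Finset.mem_filter.1 hi).1) (hcard b)
  let U : ℕ → Finset α := fun n => C.filter fun c => c ∈ S (g c) n
  have hU : ∀ n b, (U n).filter (fun c => g c = b) = S b n := by
    intro n b
    ext c
    simp only [U, Finset.mem_filter]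
    constructor
    · rintro ⟨⟨_, h⟩, rfl⟩
      exact h
    · intro h
      obtain ⟨h1, rfl⟩ := Finset.mem_filter.1 ((hS b n).1 h)
      exact ⟨⟨h1, h⟩, rfl⟩
  have hUC : ∀ n, U n ⊆ C := fun n => Finset.filter_subset _ _
  have htot : ∑ i ∈ C, p i ≤ ∑ n ∈ Finset.Icc 1 (2 ^ D), labelWeight n * ∑ i ∈ U n, p i := by
    have e1 : ∀ n, ∑ i ∈ U n, p i = ∑ b ∈ C.image g, ∑ i ∈ S b n, p i := by
      intro n
      rw [← Finset.sum_fiberwise_of_maps_to (t := C.image g) (g := g)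
        fun i hi => Finset.mem_image_of_mem g (hUC n hi)]
      simp only [hU]
    rw [← Finset.sum_fiberwise_of_maps_to (t := C.image g) (g := g)
        fun i hi => Finset.mem_image_of_mem g hi]
    refine (Finset.sum_le_sum fun b _ => hsum b).trans (le_of_eq ?_)
    rw [Finset.sum_comm]
    simp only [e1, Finset.mul_sum]
  obtain ⟨n, hn, hle⟩ : ∃ n ∈ Finset.Icc 1 (2 ^ D),
      ∑ i ∈ C, p i ≤ (2 * D + 2) * ∑ i ∈ U n, p i := by
    by_contra! hcon
    have hW : 0 ≤ ∑ i ∈ C, p i := Finset.sum_nonneg hp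
    have hpos : (0 : ℝ) < 2 * D + 2 := by positivity
    have hlt : ∑ n ∈ Finset.Icc 1 (2 ^ D), labelWeight n * ((2 * D + 2) * ∑ i ∈ U n, p i) <
        ∑ n ∈ Finset.Icc 1 (2 ^ D), labelWeight n * ∑ i ∈ C, p i :=
      Finset.sum_lt_sum_of_nonempty ⟨1, Finset.mem_Icc.2 ⟨le_rfl, Nat.one_le_two_pow⟩⟩
        fun n hn => mul_lt_mul_of_pos_left (hcon n hn) (labelWeight_pos (Finset.mem_Icc.1 hn).1)
    rw [← Finset.sum_mul] at hlt
    have h1 := mul_le_mul_of_nonneg_right (sum_labelWeight_le hD) hW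
    have h2 := mul_le_mul_of_nonneg_left htot hpos.le
    have h3 : ∑ n ∈ Finset.Icc 1 (2 ^ D), labelWeight n * ((2 * D + 2) * ∑ i ∈ U n, p i) =
        ∑ n ∈ Finset.Icc 1 (2 ^ D), (2 * (D : ℝ) + 2) * (labelWeight n * ∑ i ∈ U n, p i) :=
      Finset.sum_congr rfl fun n _ => by ring
    rw [← Finset.mul_sum] at h3
    linarith
  rw [Finset.mem_Icc] at hn
  refine ⟨branchLabel n, ⟨one_le_branchLabel hn.1, (branchLabel_le hn.1).trans ?_⟩, U n, hUC n,
    fun b => ?_, hle⟩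
  · exact_mod_cast hn.2
  · rw [hU]
    exact (hS b n).2

/-- The mass of the part of `K` whose `i`-th ancestor is `b`. -/
def ancestorMass {α : Type*} [DecidableEq α] (par : α → α) (m : α → ℝ) (K : Finset α) (i : ℕ)
    (b : α) : ℝ :=
  ∑ k ∈ K with par^[i] k = b, m k

/-- `K`, the set of leaves of a tree of height `ℓ`, is regular: in each generation all the
branching numbers agree up to a factor `2`. -/
def IsRegularFamily {α : Type*} [DecidableEq α] (D ℓ : ℕ) (par : α → α) (m : α → ℝ)
    (K : Finset α) : Prop :=
  ∃ a : ℕ → ℝ, ∀ i < ℓ, a i ∈ Set.Icc (1 : ℝ) (2 ^ D) ∧ ∀ k ∈ K,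
    a i * ancestorMass par m K i (par^[i] k) ≤ ancestorMass par m K (i + 1) (par^[i + 1] k) ∧
    ancestorMass par m K (i + 1) (par^[i + 1] k) ≤
      2 * a i * ancestorMass par m K i (par^[i] k)

lemma exists_isRegularFamily {α : Type*} [DecidableEq α] {D : ℕ} (hD : 1 ≤ D) {par : α → α}
    (hpar : ∀ (C : Finset α) b, (C.filter fun c => par c = b).card ≤ 2 ^ D) {m : α → ℝ}
    {K₀ : Finset α} (hm : ∀ k ∈ K₀, 0 ≤ m k) (ℓ : ℕ) :
    ∃ K ⊆ K₀, IsRegularFamily D ℓ par m K ∧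
      ∑ k ∈ K₀, m k ≤ (2 * D + 2) ^ ℓ * ∑ k ∈ K, m k := by
  induction ℓ with
  | zero => exact ⟨K₀, subset_rfl, ⟨fun _ => 0, fun i hi => by omega⟩, by simp⟩
  | succ ℓ ih =>
    obtain ⟨K, hK, ⟨a, ha⟩, hsum⟩ := ih
    obtain ⟨a', ha', S, hS, hbal, hle⟩ := exists_balanced_fibres hD (K.image par^[ℓ]) par
      (ancestorMass par m K ℓ)
      (fun b _ => Finset.sum_nonneg fun k hk => hm k (hK (Finset.mem_filter.1 hk).1))
      (fun b => hpar _ b)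
    set K' := K.filter fun k => par^[ℓ] k ∈ S with hK'
    have hmass : ∀ i ≤ ℓ, ∀ k ∈ K',
        ancestorMass par m K' i (par^[i] k) = ancestorMass par m K i (par^[i] k) := by
      intro i hi k hk
      unfold ancestorMass
      congr 1
      ext k'
      simp only [hK', Finset.mem_filter, and_assoc, and_congr_right_iff, and_iff_right_iff_imp]
      intro _ h
      have e : ∀ x, par^[ℓ] x = par^[ℓ - i] (par^[i] x) := fun x => by
        rw [← Function.iterate_add_apply, Nat.sub_add_cancel hi]
      rw [e, h, ← e]
      exact (Finset.mem_filter.1 hk).2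
    have htop : ∀ b, ancestorMass par m K' (ℓ + 1) b =
        ∑ c ∈ S with par c = b, ancestorMass par m K ℓ c := by
      intro b
      unfold ancestorMass
      rw [← Finset.sum_fiberwise_of_maps_to (s := K'.filter fun k => par^[ℓ + 1] k = b)
        (t := S.filter fun c => par c = b) (g := par^[ℓ])]
      · refine Finset.sum_congr rfl fun c hc => ?_
        congr 1
        ext k
        simp only [hK', Finset.mem_filter, Function.iterate_succ_apply'] at hc ⊢
        constructor
        · rintro ⟨⟨⟨h1, -⟩, -⟩, h2⟩
          exact ⟨h1, h2⟩
        · rintro ⟨h1, rfl⟩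
          exact ⟨⟨⟨h1, hc.1⟩, hc.2⟩, rfl⟩
      · intro k hk
        simp only [hK', Finset.mem_filter, Function.iterate_succ_apply'] at hk ⊢
        exact ⟨hk.1.2, hk.2⟩
    refine ⟨K', (Finset.filter_subset _ _).trans hK, ⟨fun i => if i = ℓ then a' else a i, ?_⟩, ?_⟩
    · intro i hi
      rcases Nat.lt_succ_iff_lt_or_eq.1 hi with hi | rfl
      · simp only [if_neg hi.ne]
        refine ⟨(ha i hi).1, fun k hk => ?_⟩
        rw [hmass i hi.le k hk, hmass (i + 1) hi k hk]
        exact (ha i hi).2 k (Finset.mem_filter.1 hk).1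
      · simp only [if_true]
        refine ⟨ha', fun k hk => ?_⟩
        rw [hmass i le_rfl k hk, htop, Function.iterate_succ_apply']
        exact hbal _ (par^[i] k) (Finset.mem_filter.2 ⟨(Finset.mem_filter.1 hk).2, rfl⟩)
    · have e1 : ∑ k ∈ K, m k = ∑ c ∈ K.image par^[ℓ], ancestorMass par m K ℓ c :=
        (Finset.sum_fiberwise_of_maps_to (fun k hk => Finset.mem_image_of_mem _ hk) _).symm
      have e2 : ∑ k ∈ K', m k = ∑ c ∈ S, ancestorMass par m K ℓ c := by
        rw [← Finset.sum_fiberwise_of_maps_to (s := K') (t := S) (g := par^[ℓ])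
          fun k hk => (Finset.mem_filter.1 hk).2]
        refine Finset.sum_congr rfl fun c hc => ?_
        unfold ancestorMass
        congr 1
        ext k
        simp only [hK', Finset.mem_filter]
        constructor
        · rintro ⟨⟨h1, -⟩, h2⟩
          exact ⟨h1, h2⟩
        · rintro ⟨h1, rfl⟩
          exact ⟨⟨h1, hc⟩, rfl⟩
      rw [e2]
      refine hsum.trans ?_
      rw [pow_succ, mul_assoc, e1]
      exact mul_le_mul_of_nonneg_left hle (by positivity)

/-- Regular families can be extracted repeatedly until the remaining mass is at most `δ`. -/
lemma exists_regular_decomposition {α : Type*} [DecidableEq α] {D : ℕ} (hD : 1 ≤ D)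
    {par : α → α} (hpar : ∀ (C : Finset α) b, (C.filter fun c => par c = b).card ≤ 2 ^ D)
    {m : α → ℝ} (ℓ : ℕ) {δ : ℝ} (hδ : 0 < δ) (K₀ : Finset α) (hm : ∀ k ∈ K₀, 0 ≤ m k) :
    ∃ P : Finset (Finset α), (P : Set (Finset α)).PairwiseDisjoint id ∧
      (∀ K ∈ P, K ⊆ K₀ ∧ IsRegularFamily D ℓ par m K ∧ δ ≤ (2 * D + 2) ^ ℓ * ∑ k ∈ K, m k) ∧
      ∑ k ∈ K₀, m k ≤ δ + ∑ K ∈ P, ∑ k ∈ K, m k := by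
  induction K₀ using Finset.strongInduction with
  | H K₀ ih =>
    rcases le_or_gt (∑ k ∈ K₀, m k) δ with h | h
    · exact ⟨∅, by simp, by simp, by simpa using h⟩
    obtain ⟨K, hK, hreg, hle⟩ := exists_isRegularFamily hD hpar hm ℓ
    have hne : K.Nonempty := by
      rw [Finset.nonempty_iff_ne_empty]
      rintro rfl
      simp only [Finset.sum_empty, mul_zero] at hle
      linarith
    obtain ⟨P, hP, hPr, hPs⟩ := ih (K₀ \ K) (Finset.sdiff_ssubset hK hne)
      fun k hk => hm k (Finset.mem_sdiff.1 hk).1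
    have hdis : ∀ L ∈ P, Disjoint K L := fun L hL =>
      Finset.disjoint_of_subset_right (hPr L hL).1 Finset.disjoint_sdiff
    have hKP : K ∉ P := fun hKP => hne.ne_empty (disjoint_self.1 (hdis K hKP))
    refine ⟨insert K P, ?_, ?_, ?_⟩
    · rw [Finset.coe_insert]
      exact hP.insert fun L hL _ => hdis L hL
    · intro L hL
      rcases Finset.mem_insert.1 hL with rfl | hL
      · exact ⟨hK, hreg, h.le.trans hle⟩
      · obtain ⟨h1, h2⟩ := hPr L hL
        exact ⟨h1.trans Finset.sdiff_subset, h2⟩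
    · rw [Finset.sum_insert hKP]
      have := Finset.sum_sdiff (f := m) hK
      linarith

lemma mem_dyadicCube_iff {d n : ℕ} {k : Fin d → ℤ} {x : EuclideanSpace ℝ (Fin d)} :
    x ∈ dyadicCube d n k ↔ (fun i => ⌊x i * 2 ^ n⌋) = k := by
  have h2 : (0 : ℝ) < 2 ^ n := by positivity
  simp only [dyadicCube, Set.mem_ofPred_eq, funext_iff, Int.floor_eq_iff, div_le_iff₀ h2,
    lt_div_iff₀ h2]

lemma measurableSet_dyadicCube (d n : ℕ) (k : Fin d → ℤ) : MeasurableSet (dyadicCube d n k) := by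
  have : dyadicCube d n k = ⋂ i, {x : EuclideanSpace ℝ (Fin d) |
      (k i : ℝ) / 2 ^ n ≤ x i ∧ x i < ((k i : ℝ) + 1) / 2 ^ n} := by
    ext x
    simp [dyadicCube]
  rw [this]
  refine MeasurableSet.iInter fun i => ?_
  have hi : Measurable fun x : EuclideanSpace ℝ (Fin d) => x i := by fun_prop
  exact (measurableSet_le measurable_const hi).inter (measurableSet_lt hi measurable_const)

lemma disjoint_dyadicCube {d n : ℕ} {k k' : Fin d → ℤ} (h : k ≠ k') :
    Disjoint (dyadicCube d n k) (dyadicCube d n k') :=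
  Set.disjoint_left.2 fun _ hx hx' =>
    h ((mem_dyadicCube_iff.1 hx).symm.trans (mem_dyadicCube_iff.1 hx'))

lemma volume_dyadicCube_pos (d n : ℕ) (k : Fin d → ℤ) : 0 < volume (dyadicCube d n k) := by
  have h2 : (0 : ℝ) < 2 ^ n := by positivity
  let U : Set (EuclideanSpace ℝ (Fin d)) :=
    ⋂ i, {x | (k i : ℝ) / 2 ^ n < x i ∧ x i < ((k i : ℝ) + 1) / 2 ^ n}
  have hU : IsOpen U := isOpen_iInter_of_finite fun i => by
    have hi : Continuous fun x : EuclideanSpace ℝ (Fin d) => x i := by fun_prop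
    exact (isOpen_lt continuous_const hi).inter (isOpen_lt hi continuous_const)
  have hne : U.Nonempty := by
    refine ⟨WithLp.toLp 2 fun i => ((k i : ℝ) + 1 / 2) / 2 ^ n, Set.mem_iInter.2 fun i => ?_⟩
    constructor <;> simp only <;> gcongr <;> linarith
  refine (hU.measure_pos volume hne).trans_le (measure_mono fun x hx i => ?_)
  obtain ⟨h1, h2⟩ := Set.mem_iInter.1 hx i
  exact ⟨h1.le, h2⟩

/-- The index of the dyadic cube `T` generations above the cube of index `k`. -/
def dyadicParent (d T : ℕ) (k : Fin d → ℤ) : Fin d → ℤ := fun i => (k i).fdiv (2 ^ T)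

lemma dyadicParent_floor (d T n : ℕ) (x : EuclideanSpace ℝ (Fin d)) :
    dyadicParent d T (fun i => ⌊x i * 2 ^ (n + T)⌋) = fun i => ⌊x i * 2 ^ n⌋ := by
  funext i
  have h2 : (0 : ℝ) < 2 ^ T := by positivity
  rw [dyadicParent, Int.fdiv_eq_ediv_of_nonneg _ (by positivity)]
  have := Int.floor_div_natCast (x i * 2 ^ (n + T)) (2 ^ T)
  push_cast at this
  rw [← this, pow_add]
  congr 1
  field_simp

lemma iterate_dyadicParent_floor (d T j i : ℕ) (x : EuclideanSpace ℝ (Fin d)) :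
    (dyadicParent d T)^[i] (fun r => ⌊x r * 2 ^ (T * (j + i))⌋) = fun r => ⌊x r * 2 ^ (T * j)⌋ := by
  induction i generalizing j with
  | zero => simp
  | succ i ih =>
    rw [Function.iterate_succ_apply', show j + (i + 1) = (j + 1) + i by ring, ih,
      show T * (j + 1) = T * j + T by ring, dyadicParent_floor]

lemma card_filter_dyadicParent_le (d T : ℕ) (C : Finset (Fin d → ℤ)) (b : Fin d → ℤ) :
    (C.filter fun c => dyadicParent d T c = b).card ≤ 2 ^ (d * T) := by
  have hsub : (C.filter fun c => dyadicParent d T c = b) ⊆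
      Fintype.piFinset fun i => Finset.Ico (b i * 2 ^ T) (b i * 2 ^ T + 2 ^ T) := by
    intro c hc
    obtain ⟨-, rfl⟩ := Finset.mem_filter.1 hc
    rw [Fintype.mem_piFinset]
    intro i
    have h2 : (0 : ℤ) < 2 ^ T := by positivity
    rw [dyadicParent, Int.fdiv_eq_ediv_of_nonneg _ h2.le, Finset.mem_Ico]
    have h3 := Int.emod_add_mul_ediv (c i) (2 ^ T)
    have h4 := Int.emod_nonneg (c i) h2.ne'
    have h5 := Int.emod_lt_of_pos (c i) h2
    constructor <;> linarith
  refine (Finset.card_le_card hsub).trans (le_of_eq ?_)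
  rw [Fintype.card_piFinset]
  have h2 : ((2 : ℤ) ^ T).toNat = 2 ^ T := by
    rw [show (2 : ℤ) ^ T = ((2 ^ T : ℕ) : ℤ) by push_cast; rfl, Int.toNat_natCast]
  simp [h2, ← pow_mul, mul_comm]

lemma measure_biUnion_dyadicCube {d n : ℕ} (ρ : Measure (EuclideanSpace ℝ (Fin d)))
    (K : Finset (Fin d → ℤ)) :
    ρ (⋃ k ∈ K, dyadicCube d n k) = ∑ k ∈ K, ρ (dyadicCube d n k) :=
  measure_biUnion_finset (fun _ _ _ _ h => disjoint_dyadicCube h)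
    fun k _ => measurableSet_dyadicCube d n k

lemma mem_biUnion_dyadicCube_iff {d n : ℕ} {K : Finset (Fin d → ℤ)}
    {x : EuclideanSpace ℝ (Fin d)} :
    x ∈ ⋃ k ∈ K, dyadicCube d n k ↔ (fun i => ⌊x i * 2 ^ n⌋) ∈ K := by
  simp [mem_dyadicCube_iff]

lemma measurableSet_biUnion_dyadicCube (d n : ℕ) (K : Finset (Fin d → ℤ)) :
    MeasurableSet (⋃ k ∈ K, dyadicCube d n k) :=
  K.measurableSet_biUnion fun k _ => measurableSet_dyadicCube d n k

lemma dyadicCube_inter_biUnion {d T ℓ j i : ℕ} (hij : j + i = ℓ) (q : Fin d → ℤ)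
    (K : Finset (Fin d → ℤ)) :
    dyadicCube d (T * j) q ∩ ⋃ k ∈ K, dyadicCube d (T * ℓ) k =
      ⋃ k ∈ K.filter fun k => (dyadicParent d T)^[i] k = q, dyadicCube d (T * ℓ) k := by
  subst hij
  ext x
  rw [Set.mem_inter_iff, mem_biUnion_dyadicCube_iff, mem_biUnion_dyadicCube_iff,
    mem_dyadicCube_iff, Finset.mem_filter, iterate_dyadicParent_floor, and_comm]

lemma dyadicCube_subset_dyadicSupport {d T ℓ : ℕ} {μ : Measure (EuclideanSpace ℝ (Fin d))}
    (hμ : IsDyadicMeasure d (T * ℓ) μ) {k : Fin d → ℤ} (hk : 0 < μ (dyadicCube d (T * ℓ) k)) :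
    dyadicCube d (T * ℓ) k ⊆ dyadicSupport d T μ := by
  intro x hx j
  have hxk := mem_dyadicCube_iff.1 hx
  rcases le_total j ℓ with h | h
  · obtain ⟨i, rfl⟩ := Nat.exists_eq_add_of_le h
    refine hk.trans_le (measure_mono fun y hy => mem_dyadicCube_iff.2 ?_)
    rw [← iterate_dyadicParent_floor d T j i, mem_dyadicCube_iff.1 hy, ← hxk,
      iterate_dyadicParent_floor]
  · obtain ⟨i, rfl⟩ := Nat.exists_eq_add_of_le h
    set Q := dyadicCube d (T * ℓ) k
    set R := dyadicCube d (T * (ℓ + i)) fun r => ⌊x r * 2 ^ (T * (ℓ + i))⌋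
    have hRQ : R ⊆ Q := fun y hy => mem_dyadicCube_iff.2 <| by
      rw [← iterate_dyadicParent_floor d T ℓ i, mem_dyadicCube_iff.1 hy,
        iterate_dyadicParent_floor, hxk]
    obtain ⟨c, hc⟩ := hμ.2.2 k
    have hc0 : c ≠ 0 := by
      rintro rfl
      have := congrArg (fun ρ => ρ Q) hc
      simp only [zero_smul, Measure.coe_zero, Pi.zero_apply] at this
      exact hk.ne' ((Measure.restrict_apply_self μ Q).symm.trans this)
    have := congrArg (fun ρ => ρ R) hc
    simp only [Measure.smul_apply, smul_eq_mul] at this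
    rw [Measure.restrict_apply (measurableSet_dyadicCube _ _ _),
      Measure.restrict_apply (measurableSet_dyadicCube _ _ _),
      Set.inter_eq_left.2 hRQ] at this
    rw [this]
    exact ENNReal.mul_pos hc0 (volume_dyadicCube_pos _ _ _).ne'

lemma isDyadicMeasure_normalized_restrict {d n : ℕ} {μ : Measure (EuclideanSpace ℝ (Fin d))}
    (hμ : IsDyadicMeasure d n μ) {K : Finset (Fin d → ℤ)}
    (hK : μ (⋃ k ∈ K, dyadicCube d n k) ≠ 0) :
    IsDyadicMeasure d n ((μ (⋃ k ∈ K, dyadicCube d n k))⁻¹ •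
      μ.restrict (⋃ k ∈ K, dyadicCube d n k)) := by
  obtain ⟨hprob, hunit, hrestr⟩ := hμ
  set X := ⋃ k ∈ K, dyadicCube d n k with hX
  refine ⟨⟨?_⟩, ?_, fun k => ?_⟩
  · rw [Measure.smul_apply, Measure.restrict_apply_univ, smul_eq_mul,
      ENNReal.inv_mul_cancel hK (measure_ne_top μ X)]
  · rw [Measure.smul_apply, Measure.absolutelyContinuous_of_le Measure.restrict_le_self hunit,
      smul_zero]
  · rw [Measure.restrict_smul, Measure.restrict_restrict (measurableSet_dyadicCube d n k)]
    by_cases hk : k ∈ K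
    · obtain ⟨c, hc⟩ := hrestr k
      refine ⟨(μ X)⁻¹ * c, ?_⟩
      have hsub : dyadicCube d n k ⊆ X := fun x hx =>
        mem_biUnion_dyadicCube_iff.2 (by rwa [mem_dyadicCube_iff.1 hx])
      rw [Set.inter_eq_left.2 hsub, hc, smul_smul]
    · refine ⟨0, ?_⟩
      have : dyadicCube d n k ∩ X = ∅ := by
        ext x
        rw [hX, Set.mem_inter_iff, mem_biUnion_dyadicCube_iff, mem_dyadicCube_iff]
        simp only [Set.mem_empty_iff_false, iff_false, not_and]
        rintro rfl
        exact hk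
      rw [this, Measure.restrict_empty, smul_zero, zero_smul]

lemma isRegularMeasure_of_isRegularFamily {d T ℓ : ℕ} (hT : 1 ≤ T)
    {μ : Measure (EuclideanSpace ℝ (Fin d))} (hμ : IsDyadicMeasure d (T * ℓ) μ)
    {K : Finset (Fin d → ℤ)} (hK : μ (⋃ k ∈ K, dyadicCube d (T * ℓ) k) ≠ 0)
    (hreg : IsRegularFamily (d * T) ℓ (dyadicParent d T)
      (fun k => μ.real (dyadicCube d (T * ℓ) k)) K) :
    ∃ σ : ℕ → ℝ, (∀ j, 1 ≤ j → j ≤ ℓ → σ j ∈ Set.Icc (-1 : ℝ) ((d : ℝ) - 1)) ∧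
      IsRegularMeasure d T ℓ σ ((μ (⋃ k ∈ K, dyadicCube d (T * ℓ) k))⁻¹ •
        μ.restrict (⋃ k ∈ K, dyadicCube d (T * ℓ) k)) := by
  have hprob := hμ.1
  have hT0 : (0 : ℝ) < T := by exact_mod_cast hT
  obtain ⟨a, ha⟩ := hreg
  refine ⟨fun j => Real.logb 2 (a (ℓ - j)) / T - 1, fun j h1 hj => ?_,
    isDyadicMeasure_normalized_restrict hμ hK, fun j h1 hj q hq => ?_⟩
  · obtain ⟨⟨hlo, hhi⟩, -⟩ := ha (ℓ - j) (by omega)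
    have hlog0 := Real.logb_nonneg one_lt_two hlo
    have hlog1 : Real.logb 2 (a (ℓ - j)) ≤ d * T := by
      rw [Real.logb_le_iff_le_rpow one_lt_two (by linarith)]
      exact_mod_cast hhi
    constructor
    · have := div_nonneg hlog0 hT0.le
      linarith
    · have := (div_le_iff₀ hT0).2 hlog1
      linarith
  · obtain ⟨i, rfl⟩ := Nat.exists_eq_add_of_le hj
    obtain ⟨j, rfl⟩ := Nat.exists_eq_add_of_le' h1
    set X := ⋃ k ∈ K, dyadicCube d (T * (j + 1 + i)) k
    have hν : ∀ j' i' q', j' + i' = j + 1 + i →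
        ((μ X)⁻¹ • μ.restrict X) (dyadicCube d (T * j') q') =
          (μ X)⁻¹ * ENNReal.ofReal (ancestorMass (dyadicParent d T)
            (fun k => μ.real (dyadicCube d (T * (j + 1 + i)) k)) K i' q') := by
      intro j' i' q' h
      have hsum : μ (dyadicCube d (T * j') q' ∩ X) =
          ∑ k ∈ K with (dyadicParent d T)^[i'] k = q', μ (dyadicCube d (T * (j + 1 + i)) k) := by
        rw [← measure_biUnion_dyadicCube, ← dyadicCube_inter_biUnion h]
      rw [Measure.smul_apply, Measure.restrict_apply (measurableSet_dyadicCube _ _ _), hsum,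
        ancestorMass, ENNReal.ofReal_sum_of_nonneg fun _ _ => measureReal_nonneg, smul_eq_mul]
      congr 1
      exact Finset.sum_congr rfl fun k _ => (ofReal_measureReal (measure_ne_top μ _)).symm
    have hdiff : j + 1 + i - (j + 1) = i := by omega
    obtain ⟨⟨hlo, -⟩, hbal⟩ := ha i (by omega)
    have ha0 : 0 < a i := by linarith
    have hexp : (2 : ℝ) ^ (-(T : ℝ) * (Real.logb 2 (a i) / T - 1 + 1)) = (a i)⁻¹ := by
      rw [show -(T : ℝ) * (Real.logb 2 (a i) / T - 1 + 1) = -Real.logb 2 (a i) by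
        field_simp; ring, Real.rpow_neg zero_le_two,
        Real.rpow_logb two_pos (by norm_num) ha0]
    rw [hν (j + 1) i q rfl] at hq ⊢
    have hne : (K.filter fun k => (dyadicParent d T)^[i] k = q).Nonempty := by
      rw [Finset.nonempty_iff_ne_empty]
      intro h
      simp [ancestorMass, h] at hq
    obtain ⟨k, hk⟩ := hne
    obtain ⟨hkK, rfl⟩ := Finset.mem_filter.1 hk
    obtain ⟨h2, h3⟩ := hbal k hkK
    have hpar : (fun r => ((dyadicParent d T)^[i] k r).fdiv (2 ^ T)) =
        (dyadicParent d T)^[i + 1] k := by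
      rw [Function.iterate_succ_apply']
      rfl
    have htwo : ∀ x : ℝ, (2 : ℝ≥0∞) * ENNReal.ofReal x = ENNReal.ofReal (2 * x) := fun x => by
      rw [ENNReal.ofReal_mul zero_le_two, ENNReal.ofReal_ofNat]
    simp only [Nat.add_sub_cancel, hdiff]
    rw [hpar, hexp, hν j (i + 1) _ (by omega), mul_left_comm, mul_left_comm 2,
      ← ENNReal.ofReal_mul (inv_nonneg.2 ha0.le), htwo]
    refine ⟨mul_le_mul_right (ENNReal.ofReal_le_ofReal ?_) _,
      mul_le_mul_right (ENNReal.ofReal_le_ofReal ?_) _⟩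
    · rwa [inv_mul_eq_div, le_div_iff₀ ha0, mul_comm]
    · rw [inv_mul_eq_div, div_le_iff₀ ha0]
      linarith

/-- The indices of the dyadic cubes of side `2⁻ⁿ` in `[0,1)^d` with positive measure. -/
noncomputable def positiveCubes (d n : ℕ) (μ : Measure (EuclideanSpace ℝ (Fin d))) :
    Finset (Fin d → ℤ) := by
  classical
  exact (Fintype.piFinset fun _ => Finset.Ico 0 (2 ^ n)).filter fun k => 0 < μ (dyadicCube d n k)

lemma measure_biUnion_positiveCubes {d n : ℕ} {μ : Measure (EuclideanSpace ℝ (Fin d))}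
    (hμ : IsDyadicMeasure d n μ) : μ (⋃ k ∈ positiveCubes d n μ, dyadicCube d n k) = 1 := by
  have hprob := hμ.1
  have h2 : (0 : ℝ) < 2 ^ n := by positivity
  refine le_antisymm prob_le_one ?_
  have hunit : μ {x : EuclideanSpace ℝ (Fin d) | ∀ i, 0 ≤ x i ∧ x i < 1} = 1 := by
    refine le_antisymm prob_le_one ?_
    rw [← measure_univ (μ := μ)]
    refine (measure_mono (Set.union_compl_self
      {x : EuclideanSpace ℝ (Fin d) | ∀ i, 0 ≤ x i ∧ x i < 1}).ge).trans
      ((measure_union_le _ _).trans ?_)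
    rw [hμ.2.1, add_zero]
  rw [← hunit, measure_biUnion_dyadicCube, positiveCubes, Finset.sum_filter_of_ne
    fun k _ h => pos_iff_ne_zero.2 h, ← measure_biUnion_dyadicCube]
  refine measure_mono fun x hx => mem_biUnion_dyadicCube_iff.2 (Fintype.mem_piFinset.2 fun i => ?_)
  obtain ⟨h0, h1⟩ := hx i
  rw [Finset.mem_Ico, Int.floor_nonneg, Int.floor_lt]
  push_cast
  exact ⟨by positivity, by nlinarith⟩

/-- If the disjoint sets `X i` fill all but `δ` of a probability space, then a set of measure
`μ A > δ` has relative measure at least `μ A - δ` in one of them. -/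
lemma exists_le_normalized_restrict {Ω ι : Type*} [MeasurableSpace Ω] [Fintype ι] {μ : Measure Ω}
    [IsProbabilityMeasure μ] {X : ι → Set Ω} (hX : ∀ i, MeasurableSet (X i))
    (hdis : Pairwise (Function.onFun Disjoint X)) (hpos : ∀ i, μ (X i) ≠ 0) {δ : ℝ≥0∞}
    (hδ : 1 - δ ≤ μ (⋃ i, X i)) {A : Set Ω} (hA : MeasurableSet A) (hδA : δ < μ A) :
    ∃ i, μ A - δ ≤ ((μ (X i))⁻¹ • μ.restrict (X i)) A := by
  by_contra! hcon
  have hlt : ∀ i, μ (A ∩ X i) < (μ A - δ) * μ (X i) := by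
    intro i
    have := hcon i
    rwa [Measure.smul_apply, Measure.restrict_apply hA, smul_eq_mul, mul_comm, ← div_eq_mul_inv,
      ENNReal.div_lt_iff (Or.inl (hpos i)) (Or.inl (measure_ne_top μ _))] at this
  have hcompl : μ (⋃ i, X i)ᶜ ≤ δ := by
    rw [prob_compl_eq_one_sub (MeasurableSet.iUnion hX)]
    exact tsub_le_iff_tsub_le.1 hδ
  have hle : μ A - δ ≤ ∑ i, μ (A ∩ X i) := by
    rw [tsub_le_iff_right]
    calc μ A ≤ μ ((⋃ i, A ∩ X i) ∪ (⋃ i, X i)ᶜ) := by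
          refine measure_mono fun x hx => ?_
          by_cases h : x ∈ ⋃ i, X i
          · left
            rw [← Set.inter_iUnion]
            exact ⟨hx, h⟩
          · exact Or.inr h
      _ ≤ _ := (measure_union_le _ _).trans (add_le_add (measure_iUnion_fintype_le μ _) hcompl)
  have htot : ∑ i, μ (X i) ≤ 1 := by
    rw [← tsum_fintype (L := .unconditional ι), ← measure_iUnion hdis hX]
    exact prob_le_one
  rcases isEmpty_or_nonempty ι with h | h
  · simp only [Finset.univ_eq_empty, Finset.sum_empty, nonpos_iff_eq_zero] at hle
    exact (tsub_pos_of_lt hδA).ne' hle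
  · have := ENNReal.sum_lt_sum_of_nonempty Finset.univ_nonempty fun i _ => hlt i
    rw [← Finset.mul_sum] at this
    exact absurd (hle.trans_lt this) (not_lt.2 ((mul_le_mul_right htot _).trans (mul_one _).le))

/-- **Corollary (full regularization).** Let `m = Tℓ` and let `μ` be a `2⁻ᵐ`-measure on
`[0,1)^d`. There are pairwise disjoint `2⁻ᵐ`-sets `X_1, …, X_N ⊆ supp_d(μ)` such that:
(i) `μ(X_1 ∪ … ∪ X_N) ≥ 1 − 2^{-εm}`, and for every Borel `A` with `μ(A) > 2^{-εm}` there is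
`i` with `μ_{X_i}(A) ≥ μ(A) − 2^{-εm}`; (ii) `μ(X_i) ≥ 2^{-(ε + (1/T)log₂(2dT+2))m}`;
(iii) each `μ_{X_i}` is `σ(i)`-regular for some `σ(i) ∈ [-1, d-1]^ℓ`. -/
theorem statement7 (T d ℓ : ℕ) (hT : 1 ≤ T) (hd : 1 ≤ d) (hℓ : 1 ≤ ℓ) (ε : ℝ) (hε : 0 < ε)
    (μ : Measure (EuclideanSpace ℝ (Fin d))) (hμ : IsDyadicMeasure d (T * ℓ) μ) :
    ∃ (N : ℕ) (X : Fin N → Set (EuclideanSpace ℝ (Fin d))) (K : Fin N → Finset (Fin d → ℤ)),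
      (∀ i, X i = ⋃ k ∈ K i, dyadicCube d (T * ℓ) k) ∧
      (∀ i j, i ≠ j → Disjoint (X i) (X j)) ∧
      (∀ i, X i ⊆ dyadicSupport d T μ) ∧
      (1 - ENNReal.ofReal ((2 : ℝ) ^ (-(ε * ((T * ℓ : ℕ) : ℝ)))) ≤ μ (⋃ i, X i)) ∧
      (∀ A : Set (EuclideanSpace ℝ (Fin d)), MeasurableSet A →
        ENNReal.ofReal ((2 : ℝ) ^ (-(ε * ((T * ℓ : ℕ) : ℝ)))) < μ A →
        ∃ i, μ A - ENNReal.ofReal ((2 : ℝ) ^ (-(ε * ((T * ℓ : ℕ) : ℝ)))) ≤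
          ((μ (X i))⁻¹ • μ.restrict (X i)) A) ∧
      (∀ i, ENNReal.ofReal
          ((2 : ℝ) ^ (-((ε + (1 / (T : ℝ)) * Real.logb 2 ((2 * d * T + 2 : ℕ) : ℝ)) *
            ((T * ℓ : ℕ) : ℝ)))) ≤ μ (X i)) ∧
      (∀ i, ∃ σ : ℕ → ℝ, (∀ j, 1 ≤ j → j ≤ ℓ → σ j ∈ Set.Icc (-1 : ℝ) ((d : ℝ) - 1)) ∧
        IsRegularMeasure d T ℓ σ ((μ (X i))⁻¹ • μ.restrict (X i))) := by
  have hprob := hμ.1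
  have hT0 : (0 : ℝ) < T := by exact_mod_cast hT
  set δ : ℝ := (2 : ℝ) ^ (-(ε * ((T * ℓ : ℕ) : ℝ))) with hδ
  have hδ0 : 0 < δ := Real.rpow_pos_of_pos two_pos _
  obtain ⟨P, hPdis, hPreg, hPsum⟩ := exists_regular_decomposition
    (Nat.mul_pos hd hT) (card_filter_dyadicParent_le d T)
    (m := fun k => μ.real (dyadicCube d (T * ℓ) k)) ℓ hδ0 (positiveCubes d (T * ℓ) μ)
    fun _ _ => measureReal_nonneg
  have hmass : ∀ K : Finset (Fin d → ℤ), μ (⋃ k ∈ K, dyadicCube d (T * ℓ) k) =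
      ENNReal.ofReal (∑ k ∈ K, μ.real (dyadicCube d (T * ℓ) k)) := by
    intro K
    rw [measure_biUnion_dyadicCube, ENNReal.ofReal_sum_of_nonneg fun _ _ => measureReal_nonneg]
    exact Finset.sum_congr rfl fun k _ => (ofReal_measureReal (measure_ne_top μ _)).symm
  have hbase : (0 : ℝ) < 2 * (d * T : ℕ) + 2 := by positivity
  have hpow : (2 : ℝ) ^ (-((ε + (1 / (T : ℝ)) * Real.logb 2 ((2 * d * T + 2 : ℕ) : ℝ)) *
      ((T * ℓ : ℕ) : ℝ))) * (2 * (d * T : ℕ) + 2) ^ ℓ = δ := by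
    have hb : (2 * (d * T : ℕ) + 2 : ℝ) ^ ℓ =
        2 ^ (Real.logb 2 ((2 * d * T + 2 : ℕ) : ℝ) * ℓ) := by
      rw [Real.rpow_mul zero_le_two, Real.rpow_logb two_pos (by norm_num) (by positivity),
        Real.rpow_natCast]
      push_cast
      ring
    rw [hb, hδ, ← Real.rpow_add two_pos]
    congr 1
    push_cast
    field_simp
    ring
  have hlower : ∀ K ∈ P, ENNReal.ofReal
      ((2 : ℝ) ^ (-((ε + (1 / (T : ℝ)) * Real.logb 2 ((2 * d * T + 2 : ℕ) : ℝ)) *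
        ((T * ℓ : ℕ) : ℝ)))) ≤ μ (⋃ k ∈ K, dyadicCube d (T * ℓ) k) := by
    intro K hK
    rw [hmass]
    refine ENNReal.ofReal_le_ofReal (le_of_mul_le_mul_right ?_ (pow_pos hbase ℓ))
    rw [hpow, mul_comm]
    exact (hPreg K hK).2.2
  have hne : ∀ K ∈ P, μ (⋃ k ∈ K, dyadicCube d (T * ℓ) k) ≠ 0 := fun K hK =>
    ((ENNReal.ofReal_pos.2 (Real.rpow_pos_of_pos two_pos _)).trans_le (hlower K hK)).ne'
  let e := P.equivFin
  let X : Fin P.card → Set (EuclideanSpace ℝ (Fin d)) :=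
    fun i => ⋃ k ∈ (e.symm i).1, dyadicCube d (T * ℓ) k
  have hXm : ∀ i, MeasurableSet (X i) := fun i => measurableSet_biUnion_dyadicCube d (T * ℓ) _
  have hXdis : ∀ i j, i ≠ j → Disjoint (X i) (X j) := by
    intro i j hij
    have hK : Disjoint (e.symm i).1 (e.symm j).1 := hPdis (e.symm i).2 (e.symm j).2
      fun h => hij (e.symm.injective (Subtype.ext h))
    exact Set.disjoint_left.2 fun x hx hx' => Finset.disjoint_left.1 hK
      (mem_biUnion_dyadicCube_iff.1 hx) (mem_biUnion_dyadicCube_iff.1 hx')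
  have hXsum : 1 - ENNReal.ofReal δ ≤ μ (⋃ i, X i) := by
    have h1 : μ (⋃ i, X i) =
        ENNReal.ofReal (∑ K ∈ P, ∑ k ∈ K, μ.real (dyadicCube d (T * ℓ) k)) := by
      rw [measure_iUnion (fun i j h => hXdis i j h) hXm, tsum_fintype,
        ENNReal.ofReal_sum_of_nonneg fun _ _ => Finset.sum_nonneg fun _ _ => measureReal_nonneg,
        ← Finset.sum_coe_sort P, ← e.symm.sum_comp]
      exact Finset.sum_congr rfl fun i _ => hmass _
    rw [tsub_le_iff_right, h1, ← measure_biUnion_positiveCubes hμ, hmass, add_comm,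
      ← ENNReal.ofReal_add hδ0.le
        (Finset.sum_nonneg fun _ _ => Finset.sum_nonneg fun _ _ => measureReal_nonneg)]
    exact ENNReal.ofReal_le_ofReal hPsum
  refine ⟨P.card, X, fun i => (e.symm i).1, fun i => rfl, hXdis, fun i => ?_, hXsum,
    fun A hA hδA => exists_le_normalized_restrict hXm (fun i j h => hXdis i j h)
      (fun i => hne _ (e.symm i).2) hXsum hA hδA,
    fun i => hlower _ (e.symm i).2, fun i => ?_⟩
  · refine Set.iUnion₂_subset fun k hk => dyadicCube_subset_dyadicSupport hμ ?_
    have := (hPreg _ (e.symm i).2).1 hk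
    rw [positiveCubes, Finset.mem_filter] at this
    exact this.2
  · exact isRegularMeasure_of_isRegularFamily hT hμ (hne _ (e.symm i).2)
      (hPreg _ (e.symm i).2).2.1
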